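/- Let S : Δ₂ → L(H) be a propagator on a Banach space H, i.e. S_{r,t} S_{s,r} = S_{s,t} for s ≤ r ≤ t and S_{t,t} = id. For a two-parameter map A : Δ₂ → H define the mild increment δ̂A_{s,r,t} := A_{s,t} - S_{r,t} A_{s,r} - A_{r,t}. Then for A_{s,t} := S_{s,t}(Y_s δX_{s,t} + Y'_s 𝕏_{s,t}) with (X, 𝕏) satisfying Chen's relation, one has δ̂A_{s,r,t} = -S_{r,t}( R̂^Y_{s,r} δX_{r,t} + δ̂Y'_{s,r} 𝕏_{r,t} ), where R̂^Y_{s,r} := Y_r - S_{s,r} Y_s - S_{s,r} Y'_s δX_{s,r} and δ̂Y'_{s,r} := Y'_r - S_{s,r} Y'_s. -/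

import Mathlib

open Finset

/-- Mild (propagator) version of the germ-increment identity: for
`A_{s,t} = S_{s,t}(Y_s δX_{s,t} + Y'_s 𝕏_{s,t})` under Chen's relation,
`δ̂A_{s,r,t} = -S_{r,t}(R̂^Y_{s,r} δX_{r,t} + δ̂Y'_{s,r} 𝕏_{r,t})`. -/
theorem stmt3 {H : Type*} [AddCommGroup H] [Module ℝ H]
    (T : ℝ) (e : ℕ)
    (S : ℝ → ℝ → H →ₗ[ℝ] H)
    (hSid : ∀ t, S t t = LinearMap.id)
    (hSprop : ∀ s r t, 0 ≤ s → s ≤ r → r ≤ t → t ≤ T → (S r t).comp (S s r) = S s t)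
    (X : ℝ → Fin e → ℝ) (XX : ℝ → ℝ → Fin e → Fin e → ℝ)
    (Y : ℝ → Fin e → H) (Y' : ℝ → Fin e → Fin e → H)
    (hChen : ∀ s r t, 0 ≤ s → s ≤ r → r ≤ t → t ≤ T → ∀ i j,
      XX s t i j - XX s r i j - XX r t i j = (X r i - X s i) * (X t j - X r j)) :
    ∀ s r t, 0 ≤ s → s ≤ r → r ≤ t → t ≤ T →
      S s t ((∑ i, (X t i - X s i) • Y s i) + ∑ i, ∑ j, XX s t i j • Y' s i j)
        - S r t (S s r ((∑ i, (X r i - X s i) • Y s i) + ∑ i, ∑ j, XX s r i j • Y' s i j))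
        - S r t ((∑ i, (X t i - X r i) • Y r i) + ∑ i, ∑ j, XX r t i j • Y' r i j)
      = -(S r t ((∑ j, (X t j - X r j) •
            (Y r j - S s r (Y s j) - ∑ i, (X r i - X s i) • S s r (Y' s i j)))
          + ∑ i, ∑ j, XX r t i j • (Y' r i j - S s r (Y' s i j)))) := by
  intro s r t h0 hsr hrt htT
  have hXX : ∀ i j, XX s t i j
      = XX s r i j + XX r t i j + (X t j - X r j) * (X r i - X s i) := fun i j => by
    linear_combination hChen s r t h0 hsr hrt htT i j
  have hX : ∀ i, X t i - X s i = (X r i - X s i) + (X t i - X r i) := fun i => by ring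
  rw [← hSprop s r t h0 hsr hrt htT, LinearMap.comp_apply, ← map_sub, ← map_sub, ← map_neg]
  congr 1
  have hcomm : ∑ j, ∑ i, ((X t j - X r j) * (X r i - X s i)) • S s r (Y' s i j)
      = ∑ i, ∑ j, ((X t j - X r j) * (X r i - X s i)) • S s r (Y' s i j) := sum_comm
  simp only [hXX, hX, map_add, map_sum, map_smul, add_smul, smul_sub, sum_add_distrib,
    sum_sub_distrib, smul_sum, smul_smul, hcomm]
  abel
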